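/- Let l = 3 and a = [1]. Suppose n ≡ 3 (mod 8) and n ∈ B(a). Then the number of ordered pairs (s₁, s₂) of perfect squares (nonnegative integers that are squares) with s₁ + 2s₂ = n is odd; moreover, n is the product of a prime and a perfect square. -/

import Mathlib

open scoped Classical

/-- The theta series `[i]` for modulus `l`: `∑ x^(n²)` over integers `n ≡ i (mod l)`,
viewed in `ℤ/2[[x]]` (the coefficient of `x^k` is the mod-2 count of such `n` with `n² = k`). -/
noncomputable def theta (l i : ℤ) : PowerSeries (ZMod 2) :=
  PowerSeries.mk fun k => (({n : ℤ | n ≡ i [ZMOD l] ∧ n ^ 2 = (k : ℤ)}.ncard : ℕ) : ZMod 2)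

/-- The theta series viewed in the Laurent series field `L = ℤ/2((x))`. -/
noncomputable def thetaL (l i : ℤ) : LaurentSeries (ZMod 2) := (theta l i : LaurentSeries (ZMod 2))

/-- The projection `p_{q,j}` keeping only the coefficients in degrees `≡ j (mod q)`. -/
noncomputable def proj (q j : ℤ) (f : LaurentSeries (ZMod 2)) : LaurentSeries (ZMod 2) where
  coeff n := if n ≡ j [ZMOD q] then f.coeff n else 0
  isPWO_support' := f.isPWO_support'.mono (fun n hn => by
    simp only [Function.mem_support, ne_eq] at hn ⊢
    intro h; apply hn; split_ifs <;> simp [h])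

/-- `B(g)`: the set of integers `n` such that the coefficient of `x^n` in `1/g` is `1`. -/
noncomputable def Bset (g : PowerSeries (ZMod 2)) : Set ℤ :=
  {n : ℤ | ((g : LaurentSeries (ZMod 2))⁻¹).coeff n = 1}

/-- The subring `S` of `L` generated over `ℤ/2` by `[1], …, [m]`. -/
noncomputable def Sring (l : ℤ) (m : ℕ) : Subring (LaurentSeries (ZMod 2)) :=
  Subring.closure {x | ∃ i : ℕ, 1 ≤ i ∧ i ≤ m ∧ x = thetaL l i}

/-- The subring `S` of `ℤ/2[[x]]` generated over `ℤ/2` by `[1], …, [m]`. -/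
noncomputable def SringPS (l : ℤ) (m : ℕ) : Subring (PowerSeries (ZMod 2)) :=
  Subring.closure {x | ∃ i : ℕ, 1 ≤ i ∧ i ≤ m ∧ x = theta l i}

/-- The representations of `n` by the quadratic form `x² + 2y²`. -/
def reps (n : ℤ) : Set (ℤ × ℤ) := {z | z.1 ^ 2 + 2 * z.2 ^ 2 = n}

lemma reps_finite (n : ℤ) : (reps n).Finite := by
  refine (Set.finite_Icc ((-n, -n) : ℤ × ℤ) (n, n)).subset ?_
  rintro ⟨x, y⟩ h
  simp only [reps, Set.mem_ofPred_eq] at h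
  rw [Set.mem_Icc, Prod.mk_le_mk, Prod.mk_le_mk]
  have hx : x ≤ x ^ 2 := Int.le_self_sq x
  have hx' : -x ≤ x ^ 2 := by simpa using Int.le_self_sq (-x)
  have hy : y ≤ y ^ 2 := Int.le_self_sq y
  have hy' : -y ≤ y ^ 2 := by simpa using Int.le_self_sq (-y)
  refine ⟨⟨?_, ?_⟩, ?_, ?_⟩ <;> nlinarith [sq_nonneg x, sq_nonneg y]

/-- Multiplication by `a + b√-2` on pairs of integers. -/
def mulBy (a b : ℤ) (z : ℤ × ℤ) : ℤ × ℤ := (a * z.1 - 2 * b * z.2, a * z.2 + b * z.1)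

section Split

variable {p a b : ℤ}

lemma not_dvd_of_prime_norm (hp : Prime p) (hp2 : ¬ p ∣ 2) (h : a ^ 2 + 2 * b ^ 2 = p) :
    ¬ p ∣ a ∧ ¬ p ∣ b := by
  have key : p ∣ a → p ∣ b → False := by
    rintro ⟨c, rfl⟩ ⟨d, rfl⟩
    refine hp.not_isUnit (IsUnit.of_mul_eq_one (c ^ 2 + 2 * d ^ 2) ?_)
    apply mul_left_cancel₀ hp.ne_zero
    linear_combination h
  have hab : p ∣ a → p ∣ b := by
    rintro ⟨c, rfl⟩
    have : p ∣ 2 * b ^ 2 := ⟨1 - p * c ^ 2, by linear_combination h⟩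
    exact hp.dvd_of_dvd_pow ((hp.dvd_or_dvd this).resolve_left hp2)
  have hba : p ∣ b → p ∣ a := by
    rintro ⟨c, rfl⟩
    have : p ∣ a ^ 2 := ⟨1 - 2 * p * c ^ 2, by linear_combination h⟩
    exact hp.dvd_of_dvd_pow this
  exact ⟨fun h1 => key h1 (hab h1), fun h1 => key (hba h1) h1⟩

lemma mulBy_injective (hp : Prime p) (h : a ^ 2 + 2 * b ^ 2 = p) :
    Function.Injective (mulBy a b) := by
  rintro ⟨x, y⟩ ⟨x', y'⟩ e
  simp only [mulBy, Prod.mk.injEq] at e ⊢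
  obtain ⟨e1, e2⟩ := e
  constructor <;> apply mul_left_cancel₀ hp.ne_zero
  · linear_combination (x' - x) * h + a * e1 + 2 * b * e2
  · linear_combination (y' - y) * h + a * e2 - b * e1

lemma mulBy_mem_reps (h : a ^ 2 + 2 * b ^ 2 = p) {n : ℤ} {z : ℤ × ℤ} (hz : z ∈ reps n) :
    mulBy a b z ∈ reps (p * n) := by
  simp only [reps, mulBy, Set.mem_ofPred_eq] at hz ⊢
  linear_combination n * h + (a ^ 2 + 2 * b ^ 2) * hz

lemma dvd_mulBy_snd (h : a ^ 2 + 2 * b ^ 2 = p) (z : ℤ × ℤ) :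
    p ∣ a * (mulBy a b z).2 - b * (mulBy a b z).1 :=
  ⟨z.2, by simp only [mulBy]; linear_combination z.2 * h⟩

lemma exists_mulBy_eq (hp : Prime p) (hp2 : ¬ p ∣ 2) (h : a ^ 2 + 2 * b ^ 2 = p) {n : ℤ}
    {z : ℤ × ℤ} (hz : z ∈ reps (p * n)) (hd : p ∣ a * z.2 - b * z.1) :
    ∃ w ∈ reps n, mulBy a b w = z := by
  obtain ⟨x, y⟩ := z
  obtain ⟨k, hk⟩ := hd
  simp only [reps, Set.mem_ofPred_eq] at hz hk
  have hl : p ∣ b * (a * x + 2 * b * y) :=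
    ⟨y - a * k, by linear_combination y * h - a * hk⟩
  obtain ⟨l, hl⟩ := (hp.dvd_or_dvd hl).resolve_left (not_dvd_of_prime_norm hp hp2 h).2
  refine ⟨(l, k), ?_, ?_⟩
  · apply mul_left_cancel₀ (pow_ne_zero 2 hp.ne_zero)
    linear_combination -(a * x + 2 * b * y + p * l) * hl - 2 * (a * y - b * x + p * k) * hk
      + (x ^ 2 + 2 * y ^ 2) * h + p * hz
  · simp only [mulBy, Prod.mk.injEq]
    constructor <;> apply mul_left_cancel₀ hp.ne_zero
    · linear_combination x * h - a * hl + 2 * b * hk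
    · linear_combination y * h - a * hk - b * hl

lemma dvd_or_dvd_of_mem_reps (hp : Prime p) (h : a ^ 2 + 2 * b ^ 2 = p) {n : ℤ}
    {z : ℤ × ℤ} (hz : z ∈ reps (p * n)) :
    p ∣ a * z.2 - b * z.1 ∨ p ∣ a * z.2 + b * z.1 := by
  apply hp.dvd_or_dvd
  simp only [reps, Set.mem_ofPred_eq] at hz
  exact ⟨z.2 ^ 2 - b ^ 2 * n, by linear_combination z.2 ^ 2 * h - b ^ 2 * hz⟩

/-- The representations of `n` not divisible by `a - b√-2`, an element of norm `p`. -/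
def primReps (p a b n : ℤ) : Set (ℤ × ℤ) := {z ∈ reps n | ¬ p ∣ a * z.2 + b * z.1}

lemma ncard_primReps_mul (hp : Prime p) (hp2 : ¬ p ∣ 2) (h : a ^ 2 + 2 * b ^ 2 = p) (n : ℤ) :
    (primReps p a b (p * n)).ncard = (primReps p a b n).ncard := by
  rw [← Set.ncard_image_of_injective (primReps p a b n) (mulBy_injective hp h)]
  congr 1
  have ha := (not_dvd_of_prime_norm hp hp2 h).1
  have key (w : ℤ × ℤ) : p ∣ a * (mulBy a b w).2 + b * (mulBy a b w).1 ↔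
      p ∣ a * w.2 + b * w.1 := by
    have : a * (mulBy a b w).2 + b * (mulBy a b w).1 =
        2 * (a * (a * w.2 + b * w.1)) - p * w.2 := by
      simp only [mulBy]; linear_combination - w.2 * h
    rw [this, dvd_sub_left (dvd_mul_right _ _), hp.dvd_mul, hp.dvd_mul]
    tauto
  ext z
  simp only [Set.mem_image]
  constructor
  · rintro ⟨hz, hd⟩
    obtain ⟨w, hw, rfl⟩ := exists_mulBy_eq hp hp2 h hz
      ((dvd_or_dvd_of_mem_reps hp h hz).resolve_right hd)
    exact ⟨w, ⟨hw, fun hh => hd ((key w).2 hh)⟩, rfl⟩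
  · rintro ⟨w, ⟨hw, hd⟩, rfl⟩
    exact ⟨mulBy_mem_reps h hw, fun hh => hd ((key w).1 hh)⟩

lemma ncard_reps_mul (hp : Prime p) (hp2 : ¬ p ∣ 2) (h : a ^ 2 + 2 * b ^ 2 = p) (n : ℤ) :
    (reps (p * n)).ncard = (primReps p a b (p * n)).ncard + (reps n).ncard := by
  have h' : a ^ 2 + 2 * (-b) ^ 2 = p := by rw [← h]; ring
  have hfin : (primReps p a b (p * n)).Finite := (reps_finite _).subset (Set.sep_subset _ _)
  rw [← Set.ncard_image_of_injective (reps n) (mulBy_injective hp h'),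
    ← Set.ncard_union_eq ?_ hfin ((reps_finite _).image _)]
  · congr 1
    ext z
    simp only [Set.mem_union, Set.mem_image]
    constructor
    · intro hz
      by_cases hd : p ∣ a * z.2 + b * z.1
      · exact .inr (exists_mulBy_eq hp hp2 h' hz (by simpa using hd))
      · exact .inl ⟨hz, hd⟩
    · rintro (hz | ⟨w, hw, rfl⟩)
      · exact hz.1
      · exact mulBy_mem_reps h' hw
  · rw [Set.disjoint_left]
    rintro _ hz ⟨w, hw, rfl⟩
    exact hz.2 (by simpa using dvd_mulBy_snd h' w)

lemma primReps_eq_reps (hp : Prime p) (hp2 : ¬ p ∣ 2) (h : a ^ 2 + 2 * b ^ 2 = p) {n : ℤ}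
    (hn : ¬ p ∣ n) : primReps p a b n = reps n := by
  refine Set.Subset.antisymm (Set.sep_subset _ _) fun z hz => ⟨hz, fun hd => hn ?_⟩
  have hb := (not_dvd_of_prime_norm hp hp2 h).2
  simp only [reps, Set.mem_ofPred_eq] at hz
  have : p ∣ b ^ 2 * n := by
    obtain ⟨k, hk⟩ := hd
    refine ⟨z.2 ^ 2 - k * (a * z.2 - b * z.1), ?_⟩
    linear_combination z.2 ^ 2 * h - b ^ 2 * hz - (a * z.2 - b * z.1) * hk
  exact (hp.dvd_or_dvd this).resolve_left fun hh => hb (hp.dvd_of_dvd_pow hh)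

lemma ncard_primReps_pow_mul (hp : Prime p) (hp2 : ¬ p ∣ 2) (h : a ^ 2 + 2 * b ^ 2 = p) {n : ℤ}
    (hn : ¬ p ∣ n) (e : ℕ) : (primReps p a b (p ^ e * n)).ncard = (reps n).ncard := by
  induction e with
  | zero => rw [pow_zero, one_mul, primReps_eq_reps hp hp2 h hn]
  | succ e ih => rw [pow_succ', mul_assoc, ncard_primReps_mul hp hp2 h, ih]

lemma ncard_reps_pow_mul (hp : Prime p) (hp2 : ¬ p ∣ 2) (h : a ^ 2 + 2 * b ^ 2 = p) {n : ℤ}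
    (hn : ¬ p ∣ n) (e : ℕ) : (reps (p ^ e * n)).ncard = (e + 1) * (reps n).ncard := by
  induction e with
  | zero => simp
  | succ e ih =>
    have := ncard_primReps_pow_mul hp hp2 h hn (e + 1)
    rw [pow_succ', mul_assoc] at this ⊢
    rw [ncard_reps_mul hp hp2 h, this, ih]
    ring

end Split

/-- The representations of `n` by `x² + 2y²` with `x` and `y` positive. -/
def posReps (n : ℤ) : Set (ℤ × ℤ) := {z ∈ reps n | 0 < z.1 ∧ 0 < z.2}

lemma ncard_reps_fst_pos {n : ℤ} {s : Set (ℤ × ℤ)} (hs : s ⊆ reps n) (hn : Odd n)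
    (hneg : ∀ z, -z ∈ s ↔ z ∈ s) : s.ncard = 2 * {z ∈ s | 0 < z.1}.ncard := by
  have hfin := (reps_finite n).subset hs
  have : s = {z ∈ s | 0 < z.1} ∪ (fun z => -z) '' {z ∈ s | 0 < z.1} := by
    ext z
    simp only [Set.mem_union, Set.mem_image, Set.mem_sep_iff]
    constructor
    · intro hz
      rcases lt_trichotomy z.1 0 with h0 | h0 | h0
      · exact .inr ⟨-z, ⟨(hneg z).2 hz, by simpa using h0⟩, neg_neg z⟩
      · have := hs hz
        simp only [reps, Set.mem_ofPred_eq, h0] at this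
        rw [← this] at hn
        exact absurd hn (by simp [parity_simps])
      · exact .inl ⟨hz, h0⟩
    · rintro (hz | ⟨w, hw, rfl⟩)
      · exact hz.1
      · exact (hneg w).2 hw.1
  conv_lhs => rw [this]
  have hfin' : {z ∈ s | 0 < z.1}.Finite := hfin.subset (Set.sep_subset _ _)
  rw [Set.ncard_union_eq ?_ hfin' (hfin'.image _), Set.ncard_image_of_injective _ neg_injective, two_mul]
  · rw [Set.disjoint_left]
    rintro _ hz ⟨w, hw, rfl⟩
    have h1 := hz.2
    have h2 := hw.2
    simp only [Prod.fst_neg] at h1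
    omega

lemma ncard_reps_eq {n : ℤ} (hn : Odd n) :
    (reps n).ncard = 4 * (posReps n).ncard + if IsSquare n then 2 else 0 := by
  rw [ncard_reps_fst_pos subset_rfl hn (by simp [reps])]
  have hfin := reps_finite n
  set A := {z ∈ reps n | 0 < z.1 ∧ z.2 = 0} with hA
  have hdecomp : {z ∈ reps n | 0 < z.1} =
      (posReps n ∪ (fun z => (z.1, -z.2)) '' posReps n) ∪ A := by
    ext ⟨x, y⟩
    simp only [Set.mem_union, Set.mem_image, Set.mem_sep_iff, posReps, hA, Prod.exists,
      Prod.mk.injEq]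
    constructor
    · rintro ⟨hz, hx⟩
      rcases lt_trichotomy y 0 with h0 | h0 | h0
      · exact .inl (.inr ⟨x, -y, ⟨by simpa [reps] using hz, hx, by omega⟩, rfl, by simp⟩)
      · exact .inr ⟨hz, hx, h0⟩
      · exact .inl (.inl ⟨hz, hx, h0⟩)
    · rintro ((hz | ⟨u, v, hw, rfl, rfl⟩) | hz)
      · exact ⟨hz.1, hz.2.1⟩
      · exact ⟨by simpa [reps] using hw.1, hw.2.1⟩
      · exact ⟨hz.1, hz.2.1⟩
  have hAc : A.ncard = if IsSquare n then 1 else 0 := by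
    split_ifs with hsq
    · obtain ⟨r, rfl⟩ := hsq
      have hr : r ≠ 0 := by rintro rfl; simp at hn
      rw [Set.ncard_eq_one]
      refine ⟨(|r|, 0), ?_⟩
      ext ⟨x, y⟩
      simp only [hA, reps, Set.mem_ofPred_eq, Set.mem_singleton_iff, Prod.mk.injEq]
      constructor
      · rintro ⟨h1, h2, rfl⟩
        refine ⟨?_, rfl⟩
        rw [← abs_of_pos h2, ← sq_eq_sq_iff_abs_eq_abs]
        linarith
      · rintro ⟨rfl, rfl⟩
        refine ⟨?_, abs_pos.2 hr, rfl⟩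
        rw [sq_abs]; ring
    · rw [Set.ncard_eq_zero (hfin.subset (Set.sep_subset _ _)), Set.eq_empty_iff_forall_notMem]
      rintro ⟨x, y⟩ ⟨h1, h2, h3⟩
      simp only [reps, Set.mem_ofPred_eq] at h1 h3
      exact hsq ⟨x, by rw [← h1, h3]; ring⟩
  have hP : (posReps n).Finite := hfin.subset (Set.sep_subset _ _)
  rw [hdecomp, Set.ncard_union_eq ?_ (hP.union (hP.image _)) (hfin.subset (Set.sep_subset _ _)),
    Set.ncard_union_eq ?_ hP (hP.image _), Set.ncard_image_of_injective, hAc]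
  · split_ifs <;> ring
  · rintro ⟨x, y⟩ ⟨x', y'⟩ h
    simpa using h
  · rw [Set.disjoint_left]
    rintro _ hz ⟨w, hw, rfl⟩
    have h1 := hz.2.2
    have h2 := hw.2.2
    simp only at h1
    omega
  · rw [Set.disjoint_left]
    rintro _ (hz | ⟨w, hw, rfl⟩) hA'
    · exact hz.2.2.ne' hA'.2.2
    · have h1 := hw.2.2
      have h2 := hA'.2.2
      simp only at h2
      omega

lemma exists_sq_add_two_mul_sq_eq {q : ℕ} (hq : q.Prime) (hsq : IsSquare (-2 : ZMod q)) :
    ∃ a b : ℤ, a ^ 2 + 2 * b ^ 2 = q := by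
  have := Fact.mk hq
  obtain ⟨k, hk⟩ := hsq
  set s := Nat.sqrt q
  have hs1 : q < (s + 1) * (s + 1) := Nat.lt_succ_sqrt q
  have hs2 : s * s < q := by
    refine lt_of_le_of_ne (Nat.sqrt_le q) fun h => ?_
    exact (Nat.prime_iff.1 hq).not_isSquare ⟨s, h.symm⟩
  obtain ⟨⟨i, j⟩, hij, ⟨i', j'⟩, hij', hne, heq⟩ :=
    Finset.exists_ne_map_eq_of_card_lt_of_maps_to
      (s := Finset.range (s + 1) ×ˢ Finset.range (s + 1)) (t := (Finset.univ : Finset (ZMod q)))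
      (f := fun z => (z.1 : ZMod q) - k * z.2) (by simpa [ZMod.card] using hs1) (by simp)
  simp only [Finset.mem_product, Finset.mem_range] at hij hij' heq
  set a : ℤ := i - i' with ha
  set b : ℤ := j - j' with hb
  have hdvd : (q : ℤ) ∣ a ^ 2 + 2 * b ^ 2 := by
    rw [← ZMod.intCast_zmod_eq_zero_iff_dvd]
    push_cast [ha, hb]
    linear_combination ((i : ZMod q) - i' + k * (j - j')) * heq - (j - j' : ZMod q) ^ 2 * hk
  have ha2 : a ^ 2 ≤ (s : ℤ) * s := by
    rw [← sq, sq_le_sq, abs_of_nonneg (by positivity : (0 : ℤ) ≤ s), abs_le]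
    omega
  have hb2 : b ^ 2 ≤ (s : ℤ) * s := by
    rw [← sq, sq_le_sq, abs_of_nonneg (by positivity : (0 : ℤ) ≤ s), abs_le]
    omega
  have hpos : 0 < a ^ 2 + 2 * b ^ 2 := by
    by_contra hcon
    have h1 : a = 0 := by nlinarith [sq_nonneg a, sq_nonneg b]
    have h2 : b = 0 := by nlinarith [sq_nonneg a, sq_nonneg b]
    exact hne (by rw [Prod.mk.injEq]; omega)
  obtain ⟨c, hc⟩ := hdvd
  have hs2' : (s : ℤ) * s < q := by exact_mod_cast hs2
  have hq0 : (0 : ℤ) < q := by exact_mod_cast hq.pos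
  have hc1 : 0 < c := by nlinarith
  have hc3 : c < 3 := by nlinarith
  interval_cases c
  · exact ⟨a, b, by simpa using hc⟩
  · have : Even a := by
      have : Even (a ^ 2) := ⟨q - b ^ 2, by linarith⟩
      exact (Int.even_pow.1 this).1
    obtain ⟨d, hd⟩ := this
    exact ⟨b, d, by rw [hd] at hc; linarith⟩

lemma isSquare_neg_two_of_mem_reps {q : ℕ} (hq : q.Prime) {m : ℤ}
    (hm : ¬ (q : ℤ) ∣ m) (t : ℕ) :
    ∀ z : ℤ × ℤ, z ∈ reps ((q : ℤ) ^ (2 * t + 1) * m) → IsSquare (-2 : ZMod q) := by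
  have := Fact.mk hq
  have hqp : Prime (q : ℤ) := Nat.prime_iff_prime_int.1 hq
  have hred (t : ℕ) (x y : ℤ) (hz : (x, y) ∈ reps ((q : ℤ) ^ (2 * t + 1) * m)) (hy : (q : ℤ) ∣ y) :
      ∃ c d : ℤ, q * (c ^ 2 + 2 * d ^ 2) = (q : ℤ) ^ (2 * t) * m := by
    obtain ⟨d, rfl⟩ := hy
    simp only [reps, Set.mem_ofPred_eq] at hz
    have hx : (q : ℤ) ∣ x := hqp.dvd_of_dvd_pow (n := 2)
      ⟨q ^ (2 * t) * m - 2 * q * d ^ 2, by linear_combination hz⟩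
    obtain ⟨c, rfl⟩ := hx
    exact ⟨c, d, mul_left_cancel₀ hqp.ne_zero (by linear_combination hz)⟩
  have hunit (t : ℕ) (x y : ℤ) (hz : (x, y) ∈ reps ((q : ℤ) ^ (2 * t + 1) * m)) (hy : ¬ (q : ℤ) ∣ y) :
      IsSquare (-2 : ZMod q) := by
    have hy' : (y : ZMod q) ≠ 0 := by rwa [Ne, ZMod.intCast_zmod_eq_zero_iff_dvd]
    simp only [reps, Set.mem_ofPred_eq] at hz
    have hz' := congrArg (Int.cast : ℤ → ZMod q) hz
    push_cast at hz'
    rw [CharP.cast_eq_zero, zero_pow (by omega), zero_mul] at hz'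
    refine ⟨x / y, ?_⟩
    field_simp
    linear_combination -hz'
  induction t with
  | zero =>
    rintro ⟨x, y⟩ hz
    by_cases hy : (q : ℤ) ∣ y
    · obtain ⟨c, d, h⟩ := hred _ x y hz hy
      exact absurd ⟨c ^ 2 + 2 * d ^ 2, by simpa using h.symm⟩ hm
    · exact hunit _ x y hz hy
  | succ t ih =>
    rintro ⟨x, y⟩ hz
    by_cases hy : (q : ℤ) ∣ y
    · obtain ⟨c, d, h⟩ := hred _ x y hz hy
      exact ih (c, d) (mul_left_cancel₀ hqp.ne_zero (by
        simp only [h]; ring))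
    · exact hunit _ x y hz hy

lemma eq_prime_mul_sq_of_odd_ncard {n : ℕ} (hn : Odd n) (hnsq : ¬ IsSquare n)
    (hP : Odd (posReps n).ncard) : ∃ q : ℕ, q.Prime ∧ ∃ k : ℕ, n = q * k ^ 2 := by
  have hn0 : n ≠ 0 := by rintro rfl; simp at hn
  obtain ⟨c, b, hbc, hc⟩ := Nat.sq_mul_squarefree n
  have hb0 : b ≠ 0 := by rintro rfl; simp at hbc; omega
  have hc1 : c ≠ 1 := by rintro rfl; exact hnsq ⟨b, by rw [← hbc]; ring⟩
  obtain ⟨q, hq, e, rfl⟩ := Nat.exists_prime_and_dvd hc1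
  have hqe : ¬ q ∣ e := by
    rintro ⟨f, rfl⟩
    exact hq.one_lt.ne' (Nat.isUnit_iff.1 (hc q ⟨f, by ring⟩))
  obtain ⟨t, b', hb', rfl⟩ := Nat.exists_eq_pow_mul_and_not_dvd hb0 q hq.ne_one
  set m := b' ^ 2 * e with hm
  have hnm : n = q ^ (2 * t + 1) * m := by rw [← hbc, hm]; ring
  have hqm : ¬ q ∣ m := by
    rw [hm, hq.dvd_mul]
    exact fun h => h.elim (fun h => hb' (hq.dvd_of_dvd_pow h)) hqe
  have hq2 : q ≠ 2 := by
    rintro rfl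
    rw [hnm, pow_succ] at hn
    exact absurd (Nat.odd_mul.1 (Nat.odd_mul.1 hn).1).2 (by decide)
  by_cases hmsq : IsSquare m
  · obtain ⟨r, hr⟩ := hmsq
    exact ⟨q, hq, q ^ t * r, by rw [hnm, hr]; ring⟩
  exfalso
  have hmodd : Odd m := by
    rw [hnm] at hn
    exact (Nat.odd_mul.1 hn).2
  have hqp : Prime (q : ℤ) := Nat.prime_iff_prime_int.1 hq
  have hq2' : ¬ (q : ℤ) ∣ 2 := by
    intro h
    have : q ∣ 2 := by exact_mod_cast h
    exact hq2 ((Nat.prime_dvd_prime_iff_eq hq Nat.prime_two).1 this)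
  have hqm' : ¬ (q : ℤ) ∣ m := by exact_mod_cast hqm
  have hnm' : (n : ℤ) = (q : ℤ) ^ (2 * t + 1) * m := by exact_mod_cast hnm
  have hne : (posReps n).Nonempty := by
    apply Set.nonempty_of_ncard_ne_zero
    intro h
    rw [h] at hP
    simp at hP
  obtain ⟨z, hz⟩ := hne
  obtain ⟨a, b, hab⟩ := exists_sq_add_two_mul_sq_eq hq
    (isSquare_neg_two_of_mem_reps hq hqm' t z (hnm' ▸ hz.1))
  have h1 := ncard_reps_pow_mul hqp hq2' hab hqm' (2 * t + 1)
  rw [← hnm', ncard_reps_eq (by exact_mod_cast hn), ncard_reps_eq (by exact_mod_cast hmodd),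
    if_neg (by rwa [Int.isSquare_natCast_iff]), if_neg (by rwa [Int.isSquare_natCast_iff])] at h1
  refine Nat.not_even_iff_odd.2 hP ⟨(t + 1) * (posReps m).ncard, ?_⟩
  linarith

/-- The positive representations of `n` with both coordinates prime to `3`. -/
def posReps₃ (n : ℤ) : Set (ℤ × ℤ) := {z ∈ posReps n | ¬ 3 ∣ z.1 ∧ ¬ 3 ∣ z.2}

lemma ncard_primReps_three {n : ℤ} (hn : Odd n) (h3 : 3 ∣ n) :
    (primReps 3 1 1 n).ncard = 2 * (posReps₃ n).ncard := by
  rw [ncard_reps_fst_pos (s := primReps 3 1 1 n) (Set.sep_subset _ _) hn]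
  · congr 1
    have hmod (x y : ℤ) (hz : (x, y) ∈ reps n) : (x - y) % 3 = 0 ∨ (x + y) % 3 = 0 := by
      simp only [reps, Set.mem_ofPred_eq] at hz
      have : (3 : ℤ) ∣ (x - y) * (x + y) := by
        obtain ⟨k, hk⟩ := h3
        exact ⟨k - y ^ 2, by linear_combination hz + hk⟩
      rcases Int.prime_three.dvd_or_dvd this with h | h <;> omega
    have habs (y : ℤ) : (|y| = y ∧ 0 ≤ y) ∨ (|y| = -y ∧ y < 0) := by
      rcases lt_or_ge y 0 with h | h
      · exact .inr ⟨abs_of_neg h, h⟩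
      · exact .inl ⟨abs_of_nonneg h, h⟩
    refine Set.ncard_congr (fun z _ => (z.1, |z.2|)) ?_ ?_ ?_
    · rintro ⟨x, y⟩ ⟨⟨hz, hd⟩, hx⟩
      have := hmod x y hz
      have := habs y
      simp only at hd hx
      refine ⟨⟨by simpa [reps] using hz, hx, ?_⟩, ?_, ?_⟩ <;> simp only <;> omega
    · rintro ⟨x, y⟩ ⟨x', y'⟩ ⟨⟨hz, hd⟩, hx⟩ ⟨⟨hz', hd'⟩, hx'⟩ h
      have := hmod x y hz
      have := hmod x' y' hz'
      have := habs y
      have := habs y'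
      simp only [Prod.mk.injEq] at hd hd' hx hx' h ⊢
      omega
    · rintro ⟨x, y⟩ ⟨⟨hz, hx, hy⟩, hx3, hy3⟩
      have := hmod x y hz
      simp only at hx hy hx3 hy3
      by_cases h : (x - y) % 3 = 0
      · refine ⟨(x, y), ⟨⟨hz, ?_⟩, hx⟩, ?_⟩
        · simp only; omega
        · simp only [abs_of_pos hy]
      · refine ⟨(x, -y), ⟨⟨by simpa [reps] using hz, ?_⟩, hx⟩, ?_⟩
        · simp only; omega
        · simp only [abs_neg, abs_of_pos hy]
  · intro z
    have : (3 : ℤ) ∣ 1 * (-z).2 + 1 * (-z).1 ↔ (3 : ℤ) ∣ 1 * z.2 + 1 * z.1 := by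
      simp only [Prod.snd_neg, Prod.fst_neg]; omega
    simp only [primReps, Set.mem_sep_iff, this]
    simp [reps]

lemma odd_sq_mod_eight {r : ℕ} (h : Odd r) : r ^ 2 % 8 = 1 := by
  have := Nat.odd_iff.1 h
  have h8 : r % 8 = 1 ∨ r % 8 = 3 ∨ r % 8 = 5 ∨ r % 8 = 7 := by omega
  rcases h8 with h | h | h | h <;> simp [Nat.pow_mod, h]

lemma odd_ncard_posReps₃_iff {n : ℕ} (hn : n % 8 = 1) :
    Odd (posReps₃ n).ncard ↔ ∃ m : ℕ, n = 9 * m ^ 2 := by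
  by_cases h3 : 3 ∣ n
  · obtain ⟨k, m, hm, hnm⟩ := Nat.exists_eq_pow_mul_and_not_dvd (by omega : n ≠ 0) 3 (by norm_num)
    have hmodd : Odd m := by
      have : Odd n := Nat.odd_iff.2 (by omega)
      rw [hnm] at this
      exact (Nat.odd_mul.1 this).2
    have hm' : ¬ (3 : ℤ) ∣ m := by exact_mod_cast hm
    have h1 := ncard_primReps_pow_mul Int.prime_three (a := 1) (b := 1) (by norm_num) (by norm_num)
      hm' k
    have hnm' : (n : ℤ) = 3 ^ k * m := by exact_mod_cast hnm
    rw [← hnm', ncard_primReps_three (by exact_mod_cast Nat.odd_iff.2 (by omega : n % 2 = 1))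
      (by exact_mod_cast h3), ncard_reps_eq (by exact_mod_cast hmodd)] at h1
    simp only [Int.isSquare_natCast_iff] at h1
    have h2 : Odd (posReps₃ n).ncard ↔ IsSquare m := by
      rw [Nat.odd_iff]
      split_ifs at h1 with h
      · simp only [h, iff_true]; omega
      · simp only [h, iff_false]; omega
    rw [h2]
    constructor
    · rintro ⟨r, hr⟩
      have hr1 : m % 8 = 1 := by
        rw [hr, ← sq]
        apply odd_sq_mod_eight
        rw [hr] at hmodd
        exact (Nat.odd_mul.1 hmodd).1
      rcases Nat.even_or_odd' k with ⟨j, rfl | rfl⟩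
      · obtain _ | j := j
        · simp at hnm; rw [hnm] at h3; exact absurd h3 hm
        · exact ⟨3 ^ j * r, by rw [hnm, hr]; ring⟩
      · exfalso
        rw [hnm, pow_succ, pow_mul, Nat.mul_mod, Nat.mul_mod (_ ^ _), Nat.pow_mod, hr1] at hn
        norm_num at hn
    · rintro ⟨s, hs⟩
      have hs0 : s ≠ 0 := by rintro rfl; simp at hs; omega
      obtain ⟨j, r, hr, rfl⟩ := Nat.exists_eq_pow_mul_and_not_dvd hs0 3 (by norm_num)
      have hr2 : ¬ 3 ∣ r ^ 2 := fun h => hr (Nat.prime_three.dvd_of_dvd_pow h)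
      have key : 3 ^ k * m = 3 ^ (2 * j + 2) * r ^ 2 := by rw [← hnm, hs]; ring
      have hk : k = 2 * j + 2 := by
        have e := congrArg (padicValNat 3) key
        have := Fact.mk Nat.prime_three
        rwa [padicValNat.mul (by positivity) (by rintro rfl; simp at hm),
          padicValNat.mul (by positivity) (by intro h; simp [h] at hr2),
          padicValNat.eq_zero_of_not_dvd hm, padicValNat.eq_zero_of_not_dvd hr2,
          padicValNat.prime_pow, padicValNat.prime_pow] at e
      rw [hk] at key
      exact ⟨r, by rw [← sq]; exact Nat.eq_of_mul_eq_mul_left (by positivity) key⟩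
  · have hempty : posReps₃ n = ∅ := by
      rw [Set.eq_empty_iff_forall_notMem]
      rintro ⟨x, y⟩ ⟨⟨hz, -⟩, hx, hy⟩
      simp only [reps, Set.mem_ofPred_eq] at hz hx hy
      have h1 (x : ℤ) (hx : ¬ 3 ∣ x) : x ^ 2 % 3 = 1 := by
        have : x % 3 = 1 ∨ x % 3 = 2 := by omega
        rcases this with h | h <;> simp [pow_two, Int.mul_emod, h]
      have := h1 x hx
      have := h1 y hy
      omega
    simp only [hempty, Set.ncard_empty, Nat.not_odd_zero, false_iff]
    rintro ⟨m, rfl⟩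
    exact h3 ⟨3 * m ^ 2, by ring⟩

section SupportMod

lemma coeff_sq_eq_sum_diag (y : LaurentSeries (ZMod 2)) (n : ℤ) :
    (y ^ 2).coeff n = ∑ z ∈ Finset.antidiagonal y.isPWO_support y.isPWO_support n with z.1 = z.2,
      y.coeff z.1 * y.coeff z.2 := by
  rw [sq, HahnSeries.coeff_mul, ← Finset.sum_filter_add_sum_filter_not _ (fun z => z.1 = z.2),
    add_eq_left]
  refine Finset.sum_involution (fun z _ => z.swap) ?_ ?_ ?_ ?_
  · intro z _
    rw [Prod.fst_swap, Prod.snd_swap, mul_comm, CharTwo.add_self_eq_zero]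
  · intro z hz _ h
    exact (Finset.mem_filter.1 hz).2 (congrArg Prod.snd h)
  · intro z hz
    rw [Finset.mem_filter] at hz ⊢
    exact ⟨Finset.swap_mem_antidiagonal.2 hz.1, fun h => hz.2 h.symm⟩
  · intro z _
    rfl

lemma coeff_sq_two_mul (y : LaurentSeries (ZMod 2)) (i : ℤ) :
    (y ^ 2).coeff (2 * i) = y.coeff i := by
  rw [coeff_sq_eq_sum_diag, Finset.sum_eq_single (i, i)]
  · generalize y.coeff i = c
    revert c
    decide
  · rintro ⟨u, v⟩ hz hne
    simp only [Finset.mem_filter, Finset.mem_antidiagonal] at hz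
    exact absurd (Prod.mk.injEq _ _ _ _ ▸ (by omega : u = i ∧ v = i)) hne
  · intro h
    by_contra hne
    apply h
    have hi : y.coeff i ≠ 0 := fun h0 => hne (by simp [h0])
    simp [hi, two_mul]

lemma coeff_sq_two_mul_add_one (y : LaurentSeries (ZMod 2)) (i : ℤ) :
    (y ^ 2).coeff (2 * i + 1) = 0 := by
  rw [coeff_sq_eq_sum_diag]
  refine Finset.sum_eq_zero ?_
  rintro ⟨u, v⟩ hz
  simp only [Finset.mem_filter, Finset.mem_antidiagonal] at hz
  omega

/-- All exponents of `f` are congruent to `j` modulo `q`. -/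
def ExponentsMod (q j : ℤ) (f : LaurentSeries (ZMod 2)) : Prop :=
  ∀ n, f.coeff n ≠ 0 → n ≡ j [ZMOD q]

variable {q i j : ℤ} {f g : LaurentSeries (ZMod 2)}

lemma ExponentsMod.coeff_eq_zero (hf : ExponentsMod q j f) {n : ℤ} (hn : ¬ n ≡ j [ZMOD q]) :
    f.coeff n = 0 := by
  by_contra h
  exact hn (hf n h)

lemma exponentsMod_one (f : LaurentSeries (ZMod 2)) : ExponentsMod 1 0 f :=
  fun _ _ => Int.modEq_one

lemma ExponentsMod.sq (hf : ExponentsMod q j f) : ExponentsMod (2 * q) (2 * j) (f ^ 2) := by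
  intro n hn
  obtain ⟨m, rfl | rfl⟩ := Int.even_or_odd' n
  · rw [coeff_sq_two_mul] at hn
    exact (hf m hn).mul_left'
  · exact absurd (coeff_sq_two_mul_add_one f m) hn

lemma ExponentsMod.mul (hf : ExponentsMod q i f) (hg : ExponentsMod q j g) :
    ExponentsMod q (i + j) (f * g) := by
  intro n hn
  rw [HahnSeries.coeff_mul] at hn
  obtain ⟨⟨u, v⟩, hz, -⟩ := Finset.exists_ne_zero_of_sum_ne_zero hn
  simp only [Finset.mem_antidiagonal, HahnSeries.mem_support] at hz
  rw [← hz.2.2]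
  exact (hf u hz.1).add (hg v hz.2.1)

lemma ExponentsMod.pow (hf : ExponentsMod q i f) (k : ℕ) : ExponentsMod q (k * i) (f ^ k) := by
  induction k with
  | zero =>
    intro n hn
    rw [pow_zero, HahnSeries.coeff_one] at hn
    simp only [ne_eq, ite_eq_right_iff, one_ne_zero, imp_false, not_not] at hn
    simp [hn]
  | succ k ih =>
    rw [pow_succ]
    convert ih.mul hf using 1
    push_cast
    ring

lemma exponentsMod_pow_eight (f : LaurentSeries (ZMod 2)) : ExponentsMod 8 0 (f ^ 8) := by
  have := (exponentsMod_one f).sq.sq.sq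
  rwa [← pow_mul, ← pow_mul] at this

end SupportMod

lemma inv_eq_of_eq_add_pow_four {K : Type*} [Field K] [CharP K 2] {A U : K} (hA : A ≠ 0)
    (h : A = U + A ^ 4) :
    A⁻¹ = U ^ 2 * (U * A ^ 8) + U ^ 7 * A⁻¹ ^ 8 + U ^ 5 + U * A ^ 8 * A ^ 8 + A ^ 2 := by
  have h2 : (2 : K) = 0 := CharTwo.two_eq_zero
  obtain rfl : U = A + A ^ 4 := by linear_combination -h - A ^ 4 * h2
  apply mul_left_cancel₀ hA
  have h7 : A * ((A + A ^ 4) ^ 7 * A⁻¹ ^ 8) = (1 + A ^ 3) ^ 7 := by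
    field_simp
  rw [mul_inv_cancel₀ hA, mul_add, mul_add, mul_add, mul_add, h7]
  linear_combination -(4 * A ^ 3 + 11 * A ^ 6 + 20 * A ^ 9 + 23 * A ^ 12 + 17 * A ^ 15
    + 8 * A ^ 18 + 2 * A ^ 21) * h2

/-- If `A = U + A⁴` and the exponents of `U` are `1` modulo `8`, the part of `1 / A` in degrees
`3` modulo `8` is that of `U³A⁸`. -/
lemma coeff_inv_eq {A U : LaurentSeries (ZMod 2)} (hA : A ≠ 0) (h : A = U + A ^ 4)
    (hU : ExponentsMod 8 1 U) {n : ℤ} (hn : n ≡ 3 [ZMOD 8]) :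
    (A⁻¹).coeff n = (U ^ 2 * (U * A ^ 8)).coeff n := by
  have : CharP (LaurentSeries (ZMod 2)) 2 :=
    charP_of_injective_ringHom (HahnSeries.C_injective (Γ := ℤ) (R := ZMod 2)) 2
  unfold Int.ModEq at hn
  rw [inv_eq_of_eq_add_pow_four hA h]
  simp only [HahnSeries.coeff_add]
  rw [((hU.pow 7).mul (exponentsMod_pow_eight A⁻¹)).coeff_eq_zero,
    (hU.pow 5).coeff_eq_zero,
    ((hU.mul (exponentsMod_pow_eight A)).mul (exponentsMod_pow_eight A)).coeff_eq_zero,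
    (exponentsMod_one A).sq.coeff_eq_zero]
  · simp
  all_goals
    unfold Int.ModEq
    push_cast
    omega

section Indicator

/-- The power series over `ℤ/2` whose set of exponents is `S`. -/
noncomputable def ofExponents (S : Set ℕ) : PowerSeries (ZMod 2) :=
  PowerSeries.mk fun k => if k ∈ S then 1 else 0

lemma coeff_ofExponents (S : Set ℕ) (k : ℕ) :
    PowerSeries.coeff k (ofExponents S) = if k ∈ S then 1 else 0 :=
  PowerSeries.coeff_mk _ _

lemma ofExponents_sq (S : Set ℕ) : ofExponents S ^ 2 = ofExponents {k | ∃ j ∈ S, k = 2 * j} := by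
  ext n
  rw [coeff_ofExponents]
  have hcoe := LaurentSeries.coeff_coe_powerSeries (ofExponents S ^ 2) n
  rw [PowerSeries.coe_pow] at hcoe
  rw [← hcoe]
  obtain ⟨m, rfl | rfl⟩ := Nat.even_or_odd' n
  · rw [Nat.cast_mul, Nat.cast_ofNat, coeff_sq_two_mul, LaurentSeries.coeff_coe_powerSeries,
      coeff_ofExponents]
    simp
  · rw [Nat.cast_add, Nat.cast_mul, Nat.cast_ofNat, Nat.cast_one, coeff_sq_two_mul_add_one,
      if_neg]
    rintro ⟨j, _, hj⟩
    omega

lemma coeff_ofExponents_mul (S T : Set ℕ) (n : ℕ) :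
    PowerSeries.coeff n (ofExponents S * ofExponents T) =
      (((Finset.HasAntidiagonal.antidiagonal n).filter fun z => z.1 ∈ S ∧ z.2 ∈ T).card : ZMod 2) := by
  rw [PowerSeries.coeff_mul, Finset.card_filter]
  push_cast
  refine Finset.sum_congr rfl fun z _ => ?_
  rw [coeff_ofExponents, coeff_ofExponents]
  split_ifs <;> simp_all

end Indicator

lemma theta_three_one : theta 3 1 = ofExponents {k | ∃ r, ¬ 3 ∣ r ∧ k = r ^ 2} := by
  ext k
  rw [coeff_ofExponents, theta, PowerSeries.coeff_mk]
  split_ifs with h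
  · obtain ⟨r, hr, rfl⟩ := h
    rw [show {n : ℤ | n ≡ 1 [ZMOD 3] ∧ n ^ 2 = ((r ^ 2 : ℕ) : ℤ)} =
      {if r % 3 = 1 then (r : ℤ) else -r} from ?_]
    · simp
    · ext n
      simp only [Set.mem_ofPred_eq, Set.mem_singleton_iff, Nat.cast_pow, sq_eq_sq_iff_eq_or_eq_neg,
        Int.ModEq]
      split_ifs <;> omega
  · rw [show {n : ℤ | n ≡ 1 [ZMOD 3] ∧ n ^ 2 = (k : ℤ)} = ∅ from ?_]
    · simp
    · rw [Set.eq_empty_iff_forall_notMem]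
      rintro n ⟨h1, h2⟩
      refine h ⟨n.natAbs, ?_, ?_⟩
      · simp only [Int.ModEq] at h1
        omega
      · zify
        rw [sq_abs, h2]

/-- The part of `theta 3 1` of odd degree. -/
noncomputable def oddTheta : PowerSeries (ZMod 2) :=
  ofExponents {k | ∃ r, ¬ 3 ∣ r ∧ Odd r ∧ k = r ^ 2}

lemma theta_pow_four :
    theta 3 1 ^ 4 = ofExponents {k | ∃ r, ¬ 3 ∣ r ∧ k = 4 * r ^ 2} := by
  rw [show 4 = 2 * 2 from rfl, pow_mul, theta_three_one, ofExponents_sq, ofExponents_sq]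
  congr 1
  ext k
  constructor
  · rintro ⟨_, ⟨_, ⟨r, hr, rfl⟩, rfl⟩, rfl⟩
    exact ⟨r, hr, by ring⟩
  · rintro ⟨r, hr, rfl⟩
    exact ⟨_, ⟨_, ⟨r, hr, rfl⟩, rfl⟩, by ring⟩

lemma theta_pow_eight :
    theta 3 1 ^ 8 = ofExponents {k | ∃ r, ¬ 3 ∣ r ∧ k = 8 * r ^ 2} := by
  rw [show 8 = 4 * 2 from rfl, pow_mul, theta_pow_four, ofExponents_sq]
  congr 1
  ext k
  constructor
  · rintro ⟨_, ⟨r, hr, rfl⟩, rfl⟩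
    exact ⟨r, hr, by ring⟩
  · rintro ⟨r, hr, rfl⟩
    exact ⟨_, ⟨r, hr, rfl⟩, by ring⟩

lemma theta_eq_oddTheta_add : theta 3 1 = oddTheta + theta 3 1 ^ 4 := by
  ext k
  rw [theta_pow_four, theta_three_one, oddTheta, map_add, coeff_ofExponents, coeff_ofExponents,
    coeff_ofExponents]
  simp only [Set.mem_ofPred_eq]
  by_cases h1 : ∃ r, ¬ 3 ∣ r ∧ Odd r ∧ k = r ^ 2
  · have h2 : ¬ ∃ r, ¬ 3 ∣ r ∧ k = 4 * r ^ 2 := by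
      rintro ⟨s, -, hs⟩
      obtain ⟨r, -, hr, hr'⟩ := h1
      have := odd_sq_mod_eight hr
      omega
    have h3 : ∃ r, ¬ 3 ∣ r ∧ k = r ^ 2 := h1.imp fun r hr => ⟨hr.1, hr.2.2⟩
    rw [if_pos h1, if_neg h2, if_pos h3, add_zero]
  · have h3 : (∃ r, ¬ 3 ∣ r ∧ k = r ^ 2) ↔ ∃ r, ¬ 3 ∣ r ∧ k = 4 * r ^ 2 := by
      constructor
      · rintro ⟨r, hr, hk⟩
        obtain ⟨s, rfl | rfl⟩ := Nat.even_or_odd' r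
        · exact ⟨s, by omega, by rw [hk]; ring⟩
        · exact absurd ⟨_, hr, ⟨s, rfl⟩, hk⟩ h1
      · rintro ⟨r, hr, hk⟩
        exact ⟨2 * r, by omega, by rw [hk]; ring⟩
    rw [if_neg h1, zero_add]
    simp only [h3]

lemma natCast_zmod_two_eq (n : ℕ) : (n : ZMod 2) = if Odd n then 1 else 0 := by
  split_ifs with h
  · exact ZMod.natCast_eq_one_iff_odd.2 h
  · exact ZMod.natCast_eq_zero_iff_even.2 (Nat.not_odd_iff_even.1 h)

lemma card_filter_antidiagonal_eq_ncard (N : ℕ) (hN : N % 8 = 1) :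
    ((Finset.HasAntidiagonal.antidiagonal N).filter fun z =>
      z.1 ∈ {k | ∃ r, ¬ 3 ∣ r ∧ Odd r ∧ k = r ^ 2} ∧
      z.2 ∈ {k | ∃ r, ¬ 3 ∣ r ∧ k = 8 * r ^ 2}).card = (posReps₃ N).ncard := by
  rw [← Set.ncard_coe_finset]
  symm
  refine Set.ncard_congr (fun z _ => (z.1.natAbs ^ 2, 2 * z.2.natAbs ^ 2)) ?_ ?_ ?_
  · rintro ⟨x, y⟩ ⟨⟨hz, hx, hy⟩, hx3, hy3⟩
    lift x to ℕ using hx.le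
    lift y to ℕ using hy.le
    simp only [reps, Set.mem_ofPred_eq] at hz hx3 hy3
    have hz : x ^ 2 + 2 * y ^ 2 = N := by exact_mod_cast hz
    have hxo : Odd x := by
      have : Odd (x ^ 2) := Nat.odd_iff.2 (by omega)
      exact Nat.Odd.of_mul_left (by rwa [sq] at this)
    have hye : Even y := by
      by_contra h
      have := odd_sq_mod_eight hxo
      have := odd_sq_mod_eight (Nat.not_even_iff_odd.1 h)
      omega
    obtain ⟨s, rfl⟩ := hye
    simp only [Finset.coe_filter, Finset.HasAntidiagonal.mem_antidiagonal, Set.mem_ofPred_eq, Int.natAbs_natCast]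
    exact ⟨hz, ⟨x, by omega, hxo, rfl⟩, s, by omega, by ring⟩
  · rintro ⟨x, y⟩ ⟨x', y'⟩ ⟨⟨-, hx, hy⟩, -⟩ ⟨⟨-, hx', hy'⟩, -⟩ h
    simp only [Prod.mk.injEq] at hx hy hx' hy' h ⊢
    have h1 := Nat.pow_left_injective (by norm_num : 2 ≠ 0) h.1
    have h2 := Nat.pow_left_injective (by norm_num : 2 ≠ 0) (Nat.eq_of_mul_eq_mul_left two_pos h.2)
    omega
  · rintro ⟨i, j⟩ h
    simp only [Finset.coe_filter, Finset.HasAntidiagonal.mem_antidiagonal, Set.mem_ofPred_eq] at h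
    obtain ⟨hij, ⟨r, hr, -, rfl⟩, s, hs, rfl⟩ := h
    refine ⟨(r, 2 * s), ⟨⟨?_, ?_, ?_⟩, ?_, ?_⟩, ?_⟩
    · simp only [reps, Set.mem_ofPred_eq]
      rw [← hij]
      push_cast
      ring
    · simp only; grind
    · simp only; grind
    · simp only; omega
    · simp only; omega
    · simp [Int.natAbs_mul]; ring

lemma oddTheta_mul_theta_pow_eight :
    oddTheta * theta 3 1 ^ 8 = ofExponents {k | ∃ m, Odd m ∧ k = 9 * m ^ 2} := by
  ext N
  rw [theta_pow_eight, oddTheta, coeff_ofExponents_mul, coeff_ofExponents]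
  by_cases hN : N % 8 = 1
  · rw [card_filter_antidiagonal_eq_ncard N hN, natCast_zmod_two_eq]
    simp only [odd_ncard_posReps₃_iff hN, Set.mem_ofPred_eq]
    have : (∃ m, N = 9 * m ^ 2) ↔ ∃ m, Odd m ∧ N = 9 * m ^ 2 := by
      refine exists_congr fun m => ⟨fun h => ⟨?_, h⟩, fun h => h.2⟩
      by_contra hm
      obtain ⟨s, rfl⟩ := Nat.not_odd_iff_even.1 hm
      have : 9 * (s + s) ^ 2 = 2 * (18 * s ^ 2) := by ring
      omega
    simp only [this]
  · rw [if_neg, Finset.card_eq_zero.2, Nat.cast_zero]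
    · rw [Finset.filter_eq_empty_iff]
      rintro ⟨i, j⟩ hij ⟨⟨r, -, hr, h1⟩, s, -, h2⟩
      have := odd_sq_mod_eight hr
      rw [Finset.HasAntidiagonal.mem_antidiagonal] at hij
      simp only at hij h1 h2
      omega
    · rintro ⟨m, hm, h⟩
      have := odd_sq_mod_eight hm
      omega

lemma sq_mod_three {r : ℕ} (h : ¬ 3 ∣ r) : r ^ 2 % 3 = 1 := by
  have : r % 3 = 1 ∨ r % 3 = 2 := by omega
  rcases this with h | h <;> simp [Nat.pow_mod, h]

lemma odd_of_odd_sq {r : ℕ} (h : r ^ 2 % 2 = 1) : Odd r :=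
  Nat.Odd.of_mul_left (by rwa [← Nat.odd_iff, sq] at h)

lemma odd_of_sq_add_two_mul_sq {n x y : ℕ} (hn : n % 8 = 3) (h : x ^ 2 + 2 * y ^ 2 = n) :
    Odd x ∧ Odd y := by
  have hx : Odd x := odd_of_odd_sq (by omega)
  refine ⟨hx, ?_⟩
  by_contra hy
  obtain ⟨s, rfl⟩ := Nat.not_odd_iff_even.1 hy
  have := odd_sq_mod_eight hx
  have : (s + s) ^ 2 = 4 * s ^ 2 := by ring
  omega

lemma odd_ncard_posReps_of_coeff_eq_one {n : ℕ} (hn : n % 8 = 3)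
    (h : PowerSeries.coeff n (oddTheta ^ 2 * (oddTheta * theta 3 1 ^ 8)) = 1) :
    Odd (posReps n).ncard := by
  rw [oddTheta_mul_theta_pow_eight, oddTheta, ofExponents_sq, coeff_ofExponents_mul,
    ZMod.natCast_eq_one_iff_odd] at h
  have hn3 : n % 3 = 2 := by
    obtain ⟨⟨i, j⟩, hij⟩ := Finset.card_pos.1 h.pos
    rw [Finset.mem_filter, Finset.HasAntidiagonal.mem_antidiagonal] at hij
    obtain ⟨hij, ⟨_, ⟨r, hr, -, rfl⟩, hi⟩, m, -, hj⟩ := hij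
    have := sq_mod_three hr
    simp only at hij hi hj
    omega
  convert h using 1
  rw [← Set.ncard_coe_finset]
  refine Set.ncard_congr (fun z _ => (2 * z.2.natAbs ^ 2, z.1.natAbs ^ 2)) ?_ ?_ ?_
  · rintro ⟨x, y⟩ ⟨hz, hx, hy⟩
    lift x to ℕ using hx.le
    lift y to ℕ using hy.le
    simp only [reps, Set.mem_ofPred_eq] at hz
    have hz : x ^ 2 + 2 * y ^ 2 = n := by exact_mod_cast hz
    obtain ⟨hxo, hyo⟩ := odd_of_sq_add_two_mul_sq hn hz
    have hx3 : 3 ∣ x := by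
      by_contra hx3
      have := sq_mod_three hx3
      by_cases hy3 : 3 ∣ y
      · have := Nat.pow_mod y 2 3
        rw [Nat.mod_eq_zero_of_dvd hy3] at this
        omega
      · have := sq_mod_three hy3
        omega
    have hy3 : ¬ 3 ∣ y := by
      rintro ⟨d, rfl⟩
      obtain ⟨c, rfl⟩ := hx3
      have : (3 * c) ^ 2 + 2 * (3 * d) ^ 2 = 3 * (3 * c ^ 2 + 6 * d ^ 2) := by ring
      omega
    obtain ⟨m, rfl⟩ := hx3
    simp only [Finset.coe_filter, Finset.HasAntidiagonal.mem_antidiagonal, Set.mem_ofPred_eq, Int.natAbs_natCast]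
    exact ⟨by omega, ⟨_, ⟨y, hy3, hyo, rfl⟩, rfl⟩, m, (Nat.odd_mul.1 hxo).2, by ring⟩
  · rintro ⟨x, y⟩ ⟨x', y'⟩ ⟨-, hx, hy⟩ ⟨-, hx', hy'⟩ h
    simp only [Prod.mk.injEq] at hx hy hx' hy' h ⊢
    have h1 := Nat.pow_left_injective (by norm_num : 2 ≠ 0) h.2
    have h2 := Nat.pow_left_injective (by norm_num : 2 ≠ 0) (Nat.eq_of_mul_eq_mul_left two_pos h.1)
    omega
  · rintro ⟨i, j⟩ h
    simp only [Finset.coe_filter, Finset.HasAntidiagonal.mem_antidiagonal, Set.mem_ofPred_eq] at h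
    obtain ⟨hij, ⟨_, ⟨r, -, hr, rfl⟩, rfl⟩, m, hm, rfl⟩ := h
    have := hr.pos
    have := hm.pos
    refine ⟨(3 * m, r), ⟨?_, ?_, ?_⟩, ?_⟩
    · simp only [reps, Set.mem_ofPred_eq]
      rw [← hij]
      push_cast
      ring
    · simp only; omega
    · simp only; omega
    · simp [Int.natAbs_mul]; ring

lemma ncard_pairs_of_squares {n : ℕ} (hn : n % 8 = 3) :
    {p : ℕ × ℕ | (∃ a : ℕ, p.1 = a ^ 2) ∧ (∃ b : ℕ, p.2 = b ^ 2) ∧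
      (p.1 : ℤ) + 2 * (p.2 : ℤ) = n}.ncard = (posReps n).ncard := by
  symm
  refine Set.ncard_congr (fun z _ => (z.1.natAbs ^ 2, z.2.natAbs ^ 2)) ?_ ?_ ?_
  · rintro ⟨x, y⟩ ⟨hz, -⟩
    refine ⟨⟨_, rfl⟩, ⟨_, rfl⟩, ?_⟩
    simpa [reps] using hz
  · rintro ⟨x, y⟩ ⟨x', y'⟩ ⟨-, hx, hy⟩ ⟨-, hx', hy'⟩ h
    simp only [Prod.mk.injEq] at hx hy hx' hy' h ⊢
    have h1 := Nat.pow_left_injective (by norm_num : 2 ≠ 0) h.1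
    have h2 := Nat.pow_left_injective (by norm_num : 2 ≠ 0) h.2
    omega
  · rintro ⟨_, _⟩ ⟨⟨a, rfl⟩, ⟨b, rfl⟩, h⟩
    obtain ⟨ha, hb⟩ := odd_of_sq_add_two_mul_sq hn (x := a) (y := b) (by exact_mod_cast h)
    have := ha.pos
    have := hb.pos
    refine ⟨(a, b), ⟨by simpa [reps] using h, ?_, ?_⟩, by simp⟩ <;> simp only <;> omega

lemma theta_three_one_ne_zero : theta 3 1 ≠ 0 := by
  intro h
  have := congrArg (PowerSeries.coeff 1) h
  rw [theta_three_one, coeff_ofExponents, if_pos ⟨1, by norm_num, by norm_num⟩, map_zero] at this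
  exact one_ne_zero this

lemma exponentsMod_oddTheta : ExponentsMod 8 1 (oddTheta : LaurentSeries (ZMod 2)) := by
  intro n hn
  rw [PowerSeries.coeff_coe] at hn
  split_ifs at hn with h0
  · exact absurd rfl hn
  · rw [oddTheta, coeff_ofExponents] at hn
    split_ifs at hn with h
    · obtain ⟨r, -, hr, h⟩ := h
      have := odd_sq_mod_eight hr
      unfold Int.ModEq
      omega
    · exact absurd rfl hn

theorem stmt6 (n : ℤ) (hn : n ≡ 3 [ZMOD 8]) (hnB : n ∈ Bset (theta 3 1)) :
    Odd ({p : ℕ × ℕ | (∃ a : ℕ, p.1 = a ^ 2) ∧ (∃ b : ℕ, p.2 = b ^ 2) ∧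
        (p.1 : ℤ) + 2 * (p.2 : ℤ) = n}.ncard) ∧
      ∃ p : ℕ, p.Prime ∧ ∃ k : ℤ, n = (p : ℤ) * k ^ 2 := by
  have hA : ((theta 3 1 : PowerSeries (ZMod 2)) : LaurentSeries (ZMod 2)) ≠ 0 := fun h =>
    theta_three_one_ne_zero (HahnSeries.ofPowerSeries_injective (by rw [h, map_zero]))
  have hAU : ((theta 3 1 : PowerSeries (ZMod 2)) : LaurentSeries (ZMod 2)) =
      (oddTheta : LaurentSeries (ZMod 2)) + (theta 3 1 : LaurentSeries (ZMod 2)) ^ 4 := by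
    rw [← PowerSeries.coe_pow, ← PowerSeries.coe_add, ← theta_eq_oddTheta_add]
  have hcoeff : (((theta 3 1 : PowerSeries (ZMod 2)) : LaurentSeries (ZMod 2))⁻¹).coeff n = 1 :=
    hnB
  rw [coeff_inv_eq hA hAU exponentsMod_oddTheta hn, ← PowerSeries.coe_pow, ← PowerSeries.coe_pow,
    ← PowerSeries.coe_mul, ← PowerSeries.coe_mul] at hcoeff
  have hn0 : 0 ≤ n := by
    by_contra h
    rw [PowerSeries.coeff_coe, if_pos (by omega)] at hcoeff
    exact zero_ne_one hcoeff
  lift n to ℕ using hn0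
  rw [LaurentSeries.coeff_coe_powerSeries] at hcoeff
  have hn8 : n % 8 = 3 := by
    unfold Int.ModEq at hn
    omega
  have hodd := odd_ncard_posReps_of_coeff_eq_one hn8 hcoeff
  refine ⟨by rwa [ncard_pairs_of_squares hn8], ?_⟩
  have hnsq : ¬ IsSquare n := by
    rintro ⟨r, hr⟩
    have := odd_sq_mod_eight (odd_of_odd_sq (r := r) (by rw [sq]; omega))
    rw [sq] at this
    omega
  obtain ⟨q, hq, k, hk⟩ := eq_prime_mul_sq_of_odd_ncard (Nat.odd_iff.2 (by omega)) hnsq hodd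
  exact ⟨q, hq, k, by exact_mod_cast hk⟩
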